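/- Let j ≥ 0 and r ≥ 2 be integers, y > 0 real, α_ℓ = C(j+r-1, ℓ+r-1), G(x) = −Σ_{ℓ=0}^{j} α_ℓ·x^{j-ℓ}·y^ℓ. Then G'(x)·(x+y) − G(x)·(r+j−1) = x^j·α_0·(r−1) for all real x. -/

import Mathlib

/-- The ratio of consecutive binomial coefficients `C(j + s, ℓ + s)`, in multiplicative form. -/
lemma choose_add_succ_mul_cast {j s ℓ : ℕ} (h : ℓ ≤ j) :
    ((j + s).choose (ℓ + 1 + s) : ℝ) * (ℓ + 1 + s) = (j + s).choose (ℓ + s) * ((j : ℝ) - ℓ) := by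
  have key := Nat.choose_succ_right_eq (j + s) (ℓ + s)
  rw [Nat.add_sub_add_right, Nat.add_right_comm ℓ s 1] at key
  rw [← Nat.cast_sub h]
  exact_mod_cast key

theorem stmt_13 (j r : ℕ) (hr : 2 ≤ r) (y : ℝ) (hy : 0 < y) :
    let α : ℕ → ℝ := fun ℓ => (Nat.choose (j + r - 1) (ℓ + r - 1) : ℝ)
    let G : ℝ → ℝ := fun x =>
      -(∑ ℓ ∈ Finset.range (j + 1), α ℓ * x ^ (j - ℓ) * y ^ ℓ)
    let G' : ℝ → ℝ := fun x =>
      -(∑ ℓ ∈ Finset.range (j + 1), α ℓ * ((j : ℝ) - ℓ) * x ^ (j - ℓ - 1) * y ^ ℓ)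
    ∀ x : ℝ, G' x * (x + y) - G x * ((r : ℝ) + j - 1) = x ^ j * α 0 * ((r : ℝ) - 1) := by
  intro α G G' x
  obtain ⟨s, rfl⟩ : ∃ s, r = s + 1 := ⟨r - 1, by omega⟩
  let T : ℕ → ℝ := fun ℓ => α ℓ * (ℓ + s) * x ^ (j - ℓ) * y ^ ℓ
  have telescope : ∀ ℓ ∈ Finset.range (j + 1),
      α ℓ * x ^ (j - ℓ) * y ^ ℓ * (s + j)
        - α ℓ * ((j : ℝ) - ℓ) * x ^ (j - ℓ - 1) * y ^ ℓ * (x + y) = T ℓ - T (ℓ + 1) := by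
    intro ℓ hℓ
    have hle : ℓ ≤ j := Nat.lt_succ_iff.mp (Finset.mem_range.mp hℓ)
    have ratio : α (ℓ + 1) * (ℓ + 1 + s) = α ℓ * ((j : ℝ) - ℓ) := choose_add_succ_mul_cast hle
    have hpow : ((j : ℝ) - ℓ) * x ^ (j - ℓ) = ((j : ℝ) - ℓ) * (x ^ (j - ℓ - 1) * x) := by
      rcases hle.eq_or_lt with rfl | hlt
      · simp
      · rw [← pow_succ, Nat.sub_add_cancel (by omega)]
    simp only [T, Nat.cast_add, Nat.cast_one, ← Nat.sub_sub, pow_succ]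
    linear_combination α ℓ * y ^ ℓ * hpow + x ^ (j - ℓ - 1) * y ^ ℓ * y * ratio
  have hlast : T (j + 1) = 0 := by
    have : α (j + 1) = 0 := by
      simp only [α, Nat.cast_eq_zero]
      exact Nat.choose_eq_zero_of_lt (by omega)
    simp [T, this]
  have hsum := Finset.sum_congr rfl telescope
  rw [Finset.sum_range_sub', hlast, Finset.sum_sub_distrib, ← Finset.sum_mul,
    ← Finset.sum_mul] at hsum
  have hfirst : T 0 = α 0 * s * x ^ j := by simp [T]
  simp only [G, G', Nat.cast_add, Nat.cast_one]
  linear_combination hsum + hfirst
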